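/- Let X, Y and Z be Banach spaces and let T : X ⊗̂_ε Y → Z be a 2-summing operator. Then for every x ∈ X the operator T# x : Y → Z is 2-summing with π₂(T# x) ≤ π₂(T) · ‖x‖, and T# : X → Π₂(Y,Z) is itself a 2-summing operator. -/

import Mathlib

set_option maxHeartbeats 1000000
set_option synthInstance.maxHeartbeats 400000

noncomputable section

open scoped BigOperators NNReal ENNReal
open NormedSpace

/-- The scalar field. -/
notation "𝕂" => ℝ

section Summing

variable {E F : Type} [NormedAddCommGroup E] [NormedSpace 𝕂 E]
  [NormedAddCommGroup F] [NormedSpace 𝕂 F]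

/-- The weak ℓ_q norm of a finite family of vectors:
`sup { (Σ_i ‖e*(e_i)‖^q)^(1/q) : e* ∈ E*, ‖e*‖ ≤ 1 }`. -/
def weakNorm (q : ℝ) {n : ℕ} (e : Fin n → E) : ℝ :=
  ⨆ f : {f : StrongDual 𝕂 E // ‖f‖ ≤ 1}, (∑ i, ‖(f : StrongDual 𝕂 E) (e i)‖ ^ q) ^ (1 / q)

/-- `T` satisfies the (p,q)-summing inequality with constant `C`:
`(Σ_i ‖T e_i‖^p)^(1/p) ≤ C · sup { (Σ_i ‖e*(e_i)‖^q)^(1/q) : ‖e*‖ ≤ 1 }`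
for all finite families `e_1, …, e_n`. -/
def SummingWithC (p q C : ℝ) (T : E →L[𝕂] F) : Prop :=
  ∀ (n : ℕ) (e : Fin n → E),
    (∑ i, ‖T (e i)‖ ^ p) ^ (1 / p) ≤ C * weakNorm q e

/-- `T` is (p,q)-summing. -/
def IsPQSumming (p q : ℝ) (T : E →L[𝕂] F) : Prop :=
  ∃ C, 0 ≤ C ∧ SummingWithC p q C T

/-- `T` is p-summing. -/
def IsPSumming (p : ℝ) (T : E →L[𝕂] F) : Prop := IsPQSumming p p T

/-- The p-summing norm `π_p(T)`: the least admissible constant. -/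
def pNorm (p : ℝ) (T : E →L[𝕂] F) : ℝ :=
  sInf {C | 0 ≤ C ∧ SummingWithC p p C T}

end Summing

section Eps

variable {X Y : Type} [NormedAddCommGroup X] [NormedSpace 𝕂 X]
  [NormedAddCommGroup Y] [NormedSpace 𝕂 Y]

instance : SeminormedAddCommGroup (StrongDual 𝕂 X →L[𝕂] Y) :=
  ContinuousLinearMap.toSeminormedAddCommGroup

/-- The rank-one operator `x* ↦ x*(x) • y`, realizing the elementary tensor `x ⊗ y`
inside the space of operators from `X*` to `Y`. -/
def elemTensor (x : X) (y : Y) : StrongDual 𝕂 X →L[𝕂] Y :=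
  (inclusionInDoubleDual 𝕂 X x).smulRight y

/-- The injective tensor product `X ⊗̂_ε Y`, as a submodule of the operators `X* → Y`:
the closure of the span of the elementary tensors.  (The operator norm of
`x* ↦ Σ_i x*(x_i) • y_i` is exactly the injective tensor norm of `Σ_i x_i ⊗ y_i`.) -/
def epsSub (X Y : Type) [NormedAddCommGroup X] [NormedSpace 𝕂 X]
    [NormedAddCommGroup Y] [NormedSpace 𝕂 Y] : Submodule 𝕂 (StrongDual 𝕂 X →L[𝕂] Y) :=
  (Submodule.span 𝕂 (Set.range fun p : X × Y => elemTensor p.1 p.2)).topologicalClosure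

/-- The injective tensor product `X ⊗̂_ε Y` as a normed space. -/
def EpsTensor (X Y : Type) [NormedAddCommGroup X] [NormedSpace 𝕂 X]
    [NormedAddCommGroup Y] [NormedSpace 𝕂 Y] : Type := ↥(epsSub X Y)

instance : NormedAddCommGroup (EpsTensor X Y) :=
  inferInstanceAs (NormedAddCommGroup ↥(epsSub X Y))

instance : NormedSpace 𝕂 (EpsTensor X Y) :=
  inferInstanceAs (NormedSpace 𝕂 ↥(epsSub X Y))

instance [CompleteSpace Y] : CompleteSpace (EpsTensor X Y) := by
  have h : IsClosed ((epsSub X Y : Submodule 𝕂 (StrongDual 𝕂 X →L[𝕂] Y)) : Set (StrongDual 𝕂 X →L[𝕂] Y)) := by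
    unfold epsSub
    exact Submodule.isClosed_topologicalClosure _
  exact h.completeSpace_coe

/-- The elementary tensor `x ⊗ y` as an element of `X ⊗̂_ε Y`. -/
def tmulEps (x : X) (y : Y) : EpsTensor X Y :=
  show ↥(epsSub X Y) from
    ⟨elemTensor x y,
      Submodule.le_topologicalClosure _ (Submodule.subset_span ⟨(x, y), rfl⟩)⟩

/-- For fixed `x : X`, the bounded linear map `y ↦ x ⊗ y` from `Y` to `X ⊗̂_ε Y`. -/
def tmulLeft (x : X) : Y →L[𝕂] EpsTensor X Y :=
  show Y →L[𝕂] ↥(epsSub X Y) from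
    ContinuousLinearMap.codRestrict
      (ContinuousLinearMap.smulRightL 𝕂 (StrongDual 𝕂 X) Y (inclusionInDoubleDual 𝕂 X x))
      (epsSub X Y)
      (fun y => Submodule.le_topologicalClosure _ (Submodule.subset_span ⟨(x, y), rfl⟩))

variable {Z : Type} [NormedAddCommGroup Z] [NormedSpace 𝕂 Z]

/-- The operator `T# x : Y → Z` induced by `T : X ⊗̂_ε Y → Z`, i.e. `(T# x) y = T (x ⊗ y)`. -/
def sharp (T : EpsTensor X Y →L[𝕂] Z) (x : X) : Y →L[𝕂] Z :=
  T.comp (tmulLeft x)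

end Eps

section Integral

variable {E F : Type} [NormedAddCommGroup E] [NormedSpace 𝕂 E]
  [NormedAddCommGroup F] [NormedSpace 𝕂 F]

/-- `Φ ∈ (E ⊗̂_ε F*)*` extends the bilinear form `(e, f) ↦ f (T e)` associated to `T`. -/
def ExtendsOf (T : E →L[𝕂] F) (Φ : StrongDual 𝕂 (EpsTensor E (StrongDual 𝕂 F))) : Prop :=
  ∀ (e : E) (f : StrongDual 𝕂 F), Φ (tmulEps e f) = f (T e)

/-- `T : E → F` is an integral operator: the bilinear form `(e, f) ↦ f(T e)` extends to a
bounded linear functional on `E ⊗̂_ε F*`. -/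
def IsIntegralOp (T : E →L[𝕂] F) : Prop := ∃ Φ, ExtendsOf T Φ

/-- The integral norm `‖T‖_int` of `T`: the norm of the extending functional
(the extension is unique, since the elementary tensors span a dense subspace). -/
def integralNorm (T : E →L[𝕂] F) : ℝ :=
  sInf {c | ∃ Φ, ExtendsOf T Φ ∧ ‖Φ‖ = c}

end Integral

section IntegralSpace

variable (Y Z : Type) [NormedAddCommGroup Y] [NormedSpace 𝕂 Y]
  [NormedAddCommGroup Z] [NormedSpace 𝕂 Z]

/-- The space `I(Y,Z)` of integral operators from `Y` to `Z` with the integral norm,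
realized isometrically as the subspace of `(Y ⊗̂_ε Z*)*` consisting of those functionals
that extend the bilinear form of a (necessarily unique) operator `T : Y → Z`. -/
def IntegralSub : Submodule 𝕂 (StrongDual 𝕂 (EpsTensor Y (StrongDual 𝕂 Z))) where
  carrier := {Φ | ∃ T : Y →L[𝕂] Z, ExtendsOf T Φ}
  add_mem' := by
    rintro Φ Ψ ⟨T, hT⟩ ⟨S, hS⟩
    exact ⟨T + S, fun e f => by
      simp [ExtendsOf, ContinuousLinearMap.add_apply, map_add, hT e f, hS e f]⟩
  zero_mem' := ⟨0, fun e f => by simp⟩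
  smul_mem' := by
    rintro c Φ ⟨T, hT⟩
    exact ⟨c • T, fun e f => by
      simp [ContinuousLinearMap.smul_apply, map_smul, hT e f]⟩

/-- The space `I(Y,Z)` of integral operators with the integral norm, as a normed space. -/
def IntegralSpace : Type := ↥(IntegralSub Y Z)

instance : NormedAddCommGroup (IntegralSpace Y Z) :=
  inferInstanceAs (NormedAddCommGroup ↥(IntegralSub Y Z))

instance : NormedSpace 𝕂 (IntegralSpace Y Z) :=
  inferInstanceAs (NormedSpace 𝕂 ↥(IntegralSub Y Z))

variable {Y Z}

/-- The functional in `(Y ⊗̂_ε Z*)*` underlying an element of `I(Y,Z)`. -/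
def IntegralSpace.toFunctional (Φ : IntegralSpace Y Z) : StrongDual 𝕂 (EpsTensor Y (StrongDual 𝕂 Z)) :=
  (show ↥(IntegralSub Y Z) from Φ).1

end IntegralSpace

section Aux

variable {E F : Type} [NormedAddCommGroup E] [NormedSpace ℝ E]
  [NormedAddCommGroup F] [NormedSpace ℝ F]

theorem aux_half_le {a b : ℝ} (ha : 0 ≤ a) (hb : 0 ≤ b) :
    a ^ ((1 : ℝ) / 2) ≤ b ↔ a ≤ b ^ 2 := by
  rw [← Real.sqrt_eq_rpow, Real.sqrt_le_left hb]

theorem aux_sum_nonneg {ι : Type} [Fintype ι] (e : ι → F) : 0 ≤ ∑ i, ‖e i‖ ^ 2 :=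
  Finset.sum_nonneg fun _ _ => sq_nonneg _

theorem weakNorm_two_le {n : ℕ} (e : Fin n → E) {w : ℝ} (hw : 0 ≤ w)
    (h : ∀ f : StrongDual ℝ E, ‖f‖ ≤ 1 → ∑ i, ‖f (e i)‖ ^ 2 ≤ w ^ 2) : weakNorm 2 e ≤ w := by
  unfold weakNorm
  haveI : Nonempty {f : StrongDual ℝ E // ‖f‖ ≤ 1} := ⟨⟨0, by simp⟩⟩
  refine ciSup_le fun f => ?_
  simp only [Real.rpow_two]
  exact (aux_half_le (Finset.sum_nonneg fun _ _ => sq_nonneg _) hw).2 (h f.1 f.2)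

theorem weakNorm_two_nonneg {n : ℕ} (e : Fin n → E) : 0 ≤ weakNorm 2 e := by
  unfold weakNorm
  exact Real.iSup_nonneg fun f => Real.rpow_nonneg
    (Finset.sum_nonneg fun _ _ => Real.rpow_nonneg (norm_nonneg _) _) _

theorem le_weakNorm_two {n : ℕ} (e : Fin n → E) (f : StrongDual ℝ E) (hf : ‖f‖ ≤ 1) :
    ∑ i, ‖f (e i)‖ ^ 2 ≤ weakNorm 2 e ^ 2 := by
  rw [← aux_half_le (Finset.sum_nonneg fun _ _ => sq_nonneg _) (weakNorm_two_nonneg e)]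
  unfold weakNorm
  simp only [Real.rpow_two]
  refine le_ciSup (f := fun f : {f : StrongDual ℝ E // ‖f‖ ≤ 1} =>
    (∑ i, ‖(f : StrongDual ℝ E) (e i)‖ ^ 2) ^ ((1 : ℝ) / 2)) ?_ ⟨f, hf⟩
  refine ⟨(∑ i, ‖e i‖ ^ 2) ^ ((1 : ℝ) / 2), ?_⟩
  rintro _ ⟨g, rfl⟩
  refine Real.rpow_le_rpow (Finset.sum_nonneg fun _ _ => sq_nonneg _)
    (Finset.sum_le_sum fun i _ => ?_) (by norm_num)
  exact pow_le_pow_left₀ (norm_nonneg _) (g.1.le_of_opNorm_le_of_le g.2 le_rfl |>.trans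
    (by simp)) 2

theorem summing_iff {C : ℝ} (hC : 0 ≤ C) (T : E →L[ℝ] F) :
    SummingWithC 2 2 C T ↔ ∀ (n : ℕ) (e : Fin n → E),
      ∑ i, ‖T (e i)‖ ^ 2 ≤ C ^ 2 * weakNorm 2 e ^ 2 := by
  unfold SummingWithC
  refine forall_congr' fun n => forall_congr' fun e => ?_
  simp only [Real.rpow_two]
  rw [aux_half_le (Finset.sum_nonneg fun _ _ => sq_nonneg _)
    (mul_nonneg hC (weakNorm_two_nonneg e)), mul_pow]

theorem summing_fintype {C : ℝ} (hC : 0 ≤ C) (T : E →L[ℝ] F) (hT : SummingWithC 2 2 C T)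
    {ι : Type} [Fintype ι] (e : ι → E) {w : ℝ} (hw : 0 ≤ w)
    (h : ∀ f : StrongDual ℝ E, ‖f‖ ≤ 1 → ∑ i, ‖f (e i)‖ ^ 2 ≤ w ^ 2) :
    ∑ i, ‖T (e i)‖ ^ 2 ≤ C ^ 2 * w ^ 2 := by
  let g := (Fintype.equivFin ι).symm
  have h1 := (summing_iff hC T).1 hT _ (fun k => e (g k))
  have h2 : weakNorm 2 (fun k => e (g k)) ≤ w := by
    refine weakNorm_two_le _ hw fun f hf => ?_
    rw [Equiv.sum_comp g (fun i => ‖f (e i)‖ ^ 2)]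
    exact h f hf
  rw [Equiv.sum_comp g (fun i => ‖T (e i)‖ ^ 2)] at h1
  refine h1.trans (mul_le_mul_of_nonneg_left ?_ (sq_nonneg _))
  exact pow_le_pow_left₀ (weakNorm_two_nonneg _) h2 2

theorem pNorm_two_nonneg (T : E →L[ℝ] F) : 0 ≤ pNorm 2 T :=
  Real.sInf_nonneg fun _ h => h.1

theorem pNorm_two_le {C : ℝ} (hC : 0 ≤ C) (T : E →L[ℝ] F) (hT : SummingWithC 2 2 C T) :
    pNorm 2 T ≤ C :=
  csInf_le ⟨0, fun _ h => h.1⟩ ⟨hC, hT⟩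

theorem pNorm_two_attained (T : E →L[ℝ] F) (hT : IsPSumming 2 T) :
    SummingWithC 2 2 (pNorm 2 T) T := by
  obtain ⟨C₀, hC₀, hC₀T⟩ := hT
  intro n e
  rcases (weakNorm_two_nonneg e).eq_or_lt with h | h
  · have := hC₀T n e
    rw [← h] at this ⊢
    simpa using this
  · rw [← div_le_iff₀ h]
    refine le_csInf ⟨C₀, hC₀, hC₀T⟩ fun C hC => ?_
    rw [div_le_iff₀ h]
    exact hC.2 n e

theorem exists_near (T : E →L[ℝ] F) (hT : IsPSumming 2 T) {ε : ℝ} (hε : 0 < ε) :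
    ∃ (n : ℕ) (y : Fin n → E), weakNorm 2 y ≤ 1 ∧
      pNorm 2 T ^ 2 - ε ≤ ∑ j, ‖T (y j)‖ ^ 2 := by
  by_contra! hcon
  have h0 : 0 < pNorm 2 T ^ 2 - ε := by
    have := hcon 0 (fun i => i.elim0) (weakNorm_two_le _ zero_le_one fun f _ => by simp)
    simpa using this
  have hatt := (summing_iff (pNorm_two_nonneg T) T).1 (pNorm_two_attained T hT)
  have hs : SummingWithC 2 2 (Real.sqrt (pNorm 2 T ^ 2 - ε)) T := by
    rw [summing_iff (Real.sqrt_nonneg _), Real.sq_sqrt h0.le]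
    intro n e
    rcases (weakNorm_two_nonneg e).eq_or_lt with h | h
    · have := hatt n e
      rw [← h] at this ⊢
      simpa using this
    · set W := weakNorm 2 e with hW
      have h1 := hcon n (fun i => W⁻¹ • e i) (by
        refine weakNorm_two_le _ zero_le_one fun f hf => ?_
        have h2 := le_weakNorm_two e f hf
        rw [← hW] at h2
        simp only [map_smul, norm_smul, mul_pow, ← Finset.mul_sum, norm_inv, Real.norm_eq_abs,
          sq_abs, inv_pow] at h2 ⊢
        rw [inv_mul_le_iff₀ (by positivity)]
        simpa using h2)
      simp only [map_smul, norm_smul, mul_pow, ← Finset.mul_sum, norm_inv, Real.norm_eq_abs,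
          sq_abs, inv_pow] at h1
      rw [inv_mul_lt_iff₀ (by positivity)] at h1
      linarith
  have h3 := pNorm_two_le (Real.sqrt_nonneg _) T hs
  have h4 := pow_le_pow_left₀ (pNorm_two_nonneg T) h3 2
  rw [Real.sq_sqrt h0.le] at h4
  linarith

end Aux

section Key

variable {X Y : Type} [NormedAddCommGroup X] [NormedSpace ℝ X]
  [NormedAddCommGroup Y] [NormedSpace ℝ Y]

theorem key_norm {ι : Type} [Fintype ι] (x : ι → X) (y : ι → Y) {w : ℝ} (hw : 0 ≤ w)
    (h : ∀ (f : StrongDual ℝ X) (g : StrongDual ℝ Y), ‖g‖ ≤ 1 →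
      ∑ k, ‖f (x k)‖ ^ 2 * ‖g (y k)‖ ^ 2 ≤ (w * ‖f‖) ^ 2) (a : ι → ℝ) :
    ‖∑ k, a k • tmulLeft (x k) (y k)‖ ≤ Real.sqrt (∑ k, a k ^ 2) * w := by
  have hn : ‖∑ k, a k • tmulLeft (x k) (y k)‖
      = ‖∑ k, a k • elemTensor (x k) (y k)‖ := by
    have : (epsSub X Y).subtype (∑ k, a k • tmulLeft (x k) (y k) : EpsTensor X Y)
      = ∑ k, a k • elemTensor (x k) (y k) := by
      refine (map_sum (epsSub X Y).subtype _ _).trans ?_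
      rfl
    rw [← this]
    rfl
  rw [hn]
  refine ContinuousLinearMap.opNorm_le_bound _ (by positivity) fun f => ?_
  have hv : (∑ k, a k • elemTensor (x k) (y k)) f = ∑ k, (a k * f (x k)) • y k := by
    simp [elemTensor, ContinuousLinearMap.sum_apply, smul_smul]
  rw [hv]
  obtain ⟨g, hg, hgv⟩ := exists_dual_vector'' ℝ (∑ k, (a k * f (x k)) • y k)
  have h1 : ‖∑ k, (a k * f (x k)) • y k‖ = ∑ k, a k * (f (x k) * g (y k)) := by
    have h2 : g (∑ k, (a k * f (x k)) • y k) = ‖∑ k, (a k * f (x k)) • y k‖ := hgv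
    rw [← h2, map_sum]
    simp [mul_assoc]
  rw [h1]
  refine (Real.sum_mul_le_sqrt_mul_sqrt _ _ _).trans ?_
  rw [mul_assoc]
  refine mul_le_mul_of_nonneg_left ?_ (Real.sqrt_nonneg _)
  rw [Real.sqrt_le_left (by positivity)]
  simpa [mul_pow] using h f g hg

theorem key_weak {ι : Type} [Fintype ι] (x : ι → X) (y : ι → Y) {w : ℝ} (hw : 0 ≤ w)
    (h : ∀ (f : StrongDual ℝ X) (g : StrongDual ℝ Y), ‖g‖ ≤ 1 →
      ∑ k, ‖f (x k)‖ ^ 2 * ‖g (y k)‖ ^ 2 ≤ (w * ‖f‖) ^ 2)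
    (φ : StrongDual ℝ (EpsTensor X Y)) (hφ : ‖φ‖ ≤ 1) :
    ∑ k, ‖φ (tmulLeft (x k) (y k))‖ ^ 2 ≤ w ^ 2 := by
  set a : ι → ℝ := fun k => φ (tmulLeft (x k) (y k)) with ha
  have h1 := key_norm x y hw h a
  have h2 : φ (∑ k, a k • tmulLeft (x k) (y k)) = ∑ k, a k ^ 2 := by
    rw [map_sum]
    refine Finset.sum_congr rfl fun k _ => ?_
    rw [map_smul, smul_eq_mul, sq]
  have h3 : ∑ k, a k ^ 2 ≤ Real.sqrt (∑ k, a k ^ 2) * w := by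
    rw [← h2]
    refine (le_abs_self _).trans ?_
    have := φ.le_of_opNorm_le_of_le hφ h1
    rw [h2] at this ⊢
    simpa using this
  have h4 : ∑ k, ‖φ (tmulLeft (x k) (y k))‖ ^ 2 = ∑ k, a k ^ 2 := by
    simp [ha]
  rw [h4]
  have hS : 0 ≤ ∑ k, a k ^ 2 := Finset.sum_nonneg fun _ _ => sq_nonneg _
  have h5 := Real.sq_sqrt hS
  have h6 := Real.sqrt_nonneg (∑ k, a k ^ 2)
  have h7 : Real.sqrt (∑ k, a k ^ 2) ≤ w := by
    by_contra! h8
    nlinarith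
  nlinarith

theorem weak_scale {n : ℕ} (e : Fin n → X) (f : StrongDual ℝ X) :
    ∑ i, ‖f (e i)‖ ^ 2 ≤ (weakNorm 2 e * ‖f‖) ^ 2 := by
  rcases (norm_nonneg f).eq_or_lt with h | h
  · have : f = 0 := norm_eq_zero.1 h.symm
    simp [this]
  · have h1 := le_weakNorm_two e (‖f‖⁻¹ • f) (by
      rw [norm_smul, norm_inv, norm_norm, inv_mul_cancel₀ h.ne'])
    simp only [ContinuousLinearMap.smul_apply, norm_smul, mul_pow, ← Finset.mul_sum, norm_inv,
      norm_norm, inv_pow] at h1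
    rw [inv_mul_le_iff₀ (by positivity)] at h1
    rw [mul_pow]
    linarith

end Key

/-- Theorem 6: if `T : X ⊗̂_ε Y → Z` is a 2-summing operator, then for every
`x ∈ X` the operator `T# x : Y → Z` is 2-summing with `π₂(T# x) ≤ π₂(T) · ‖x‖`, and
`T# : X → Π₂(Y,Z)` is itself 2-summing, i.e. there is `C ≥ 0` with
`(Σ_i π₂(T# x_i)²)^(1/2) ≤ C · sup { (Σ_i |x*(x_i)|²)^(1/2) : ‖x*‖ ≤ 1 }` for all finite
families in `X`. -/
theorem statement9 (X Y Z : Type)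
    [NormedAddCommGroup X] [NormedSpace ℝ X] [CompleteSpace X]
    [NormedAddCommGroup Y] [NormedSpace ℝ Y] [CompleteSpace Y]
    [NormedAddCommGroup Z] [NormedSpace ℝ Z] [CompleteSpace Z]
    (T : EpsTensor X Y →L[ℝ] Z) (hT : IsPSumming 2 T) :
    (∀ x : X, IsPSumming 2 (sharp T x) ∧ pNorm 2 (sharp T x) ≤ pNorm 2 T * ‖x‖) ∧
    ∃ C, 0 ≤ C ∧ ∀ (n : ℕ) (v : Fin n → X),
      (∑ i, pNorm 2 (sharp T (v i)) ^ (2 : ℝ)) ^ ((1 : ℝ) / 2) ≤ C * weakNorm 2 v := by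
  have part1 : ∀ x : X, SummingWithC 2 2 (pNorm 2 T * ‖x‖) (sharp T x) := by
    intro x
    have hp := pNorm_two_nonneg T
    rw [summing_iff (by positivity)]
    intro n e
    have hw := weakNorm_two_nonneg e
    have := summing_fintype hp T (pNorm_two_attained T hT)
      (fun i => tmulLeft x (e i)) (w := ‖x‖ * weakNorm 2 e) (by positivity)
      (key_weak (fun _ => x) e (by positivity) (by
        intro f g hg
        rw [← Finset.mul_sum]
        have h1 := le_weakNorm_two e g hg
        have h2 : ‖f x‖ ^ 2 ≤ (‖f‖ * ‖x‖) ^ 2 :=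
          pow_le_pow_left₀ (norm_nonneg _) (f.le_opNorm x) 2
        calc ‖f x‖ ^ 2 * ∑ i, ‖g (e i)‖ ^ 2
            ≤ (‖f‖ * ‖x‖) ^ 2 * weakNorm 2 e ^ 2 := by gcongr
          _ = _ := by ring))
    calc ∑ i, ‖sharp T x (e i)‖ ^ 2 ≤ _ := this
      _ = _ := by ring
  have sm : ∀ x : X, IsPSumming 2 (sharp T x) := fun x =>
    ⟨_, mul_nonneg (pNorm_two_nonneg T) (norm_nonneg x), part1 x⟩
  refine ⟨fun x => ⟨sm x, pNorm_two_le (mul_nonneg (pNorm_two_nonneg T) (norm_nonneg x)) _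
    (part1 x)⟩, pNorm 2 T, pNorm_two_nonneg T, fun n v => ?_⟩
  have hw := weakNorm_two_nonneg v
  simp only [Real.rpow_two]
  rw [aux_half_le (Finset.sum_nonneg fun _ _ => sq_nonneg _)
    (mul_nonneg (pNorm_two_nonneg T) hw), mul_pow]
  have main : ∀ ε : ℝ, 0 < ε →
      ∑ i, pNorm 2 (sharp T (v i)) ^ 2 - n * ε ≤ pNorm 2 T ^ 2 * weakNorm 2 v ^ 2 := by
    intro ε hε
    choose m y hy1 hy2 using fun i => exists_near (sharp T (v i)) (sm (v i)) hε
    have h1 := summing_fintype (pNorm_two_nonneg T) T (pNorm_two_attained T hT)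
      (fun k : (i : Fin n) × Fin (m i) => tmulLeft (v k.1) (y k.1 k.2)) hw
      (key_weak (fun k : (i : Fin n) × Fin (m i) => v k.1) (fun k => y k.1 k.2) hw (by
        intro f g hg
        rw [Fintype.sum_sigma]
        refine le_trans (Finset.sum_le_sum fun i _ => ?_) (weak_scale v f)
        simp only
        rw [← Finset.mul_sum]
        have h1 := le_weakNorm_two (y i) g hg
        have h2 := pow_le_pow_left₀ (weakNorm_two_nonneg (y i)) (hy1 i) 2
        exact mul_le_of_le_one_right (sq_nonneg _) (by linarith)))
    refine le_trans ?_ h1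
    rw [Fintype.sum_sigma]
    have h3 : ∑ i, (pNorm 2 (sharp T (v i)) ^ 2 - ε)
        ≤ ∑ i, ∑ j, ‖sharp T (v i) (y i j)‖ ^ 2 := Finset.sum_le_sum fun i _ => hy2 i
    rw [Finset.sum_sub_distrib] at h3
    simp only [Finset.sum_const, Finset.card_univ, Fintype.card_fin, nsmul_eq_mul] at h3
    exact h3
  refine le_of_forall_pos_le_add fun δ hδ => ?_
  have h1 := main (δ / (n + 1)) (by positivity)
  have h2 : (n : ℝ) * (δ / (n + 1)) ≤ δ := by
    rw [mul_div_assoc', div_le_iff₀ (by positivity)]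
    nlinarith
  linarith
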